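/- Let p be an odd prime, H a proper subgroup of 𝔽_p* of index n, and c : H → ℂ* a non-trivial character. Then the set S := {(f,g) | f : 𝔽_p → ℂ is (H,c)-equivariant, g : 𝔽_p → ℂ is (H,c̄)-equivariant, f(1) = g(1) = 1, f·g = 1_H, and f̂·(ǧ)^ = 1_H}, where 1_H is the indicator function of H ⊆ 𝔽_p and ǧ(x) := g(−x), is finite with cardinality equal to the binomial coefficient binom(2n−2, n−1). -/

import Mathlib

/-- The finite Fourier transform on `ℤ/pℤ`,
`f̂ k = (1/√p) ∑_{ℓ} e^{2πikℓ/p} f ℓ`. -/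
noncomputable def fourierZMod {p : ℕ} [NeZero p] (f : ZMod p → ℂ) (k : ZMod p) : ℂ :=
  (1 / Real.sqrt p) *
    ∑ ℓ : ZMod p, Complex.exp (2 * Real.pi * Complex.I * ((k * ℓ).val : ℂ) / p) * f ℓ

open Classical in
/-- The indicator function of the subgroup `H ≤ 𝔽_p^*`, viewed inside `𝔽_p`. -/
noncomputable def indSubgroup {p : ℕ} (H : Subgroup (ZMod p)ˣ) : ZMod p → ℂ :=
  fun x => if ∃ u ∈ H, ((u : (ZMod p)ˣ) : ZMod p) = x then 1 else 0

open Polynomial in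
theorem aux_moment {K : Type*} [CommRing K] (N : ℕ) (i : ℕ) :
    ∀ (m : ℕ) (g : K[X]), g.natDegree < N → i < m → (X - C 1) ^ m ∣ g →
      ∑ j ∈ Finset.range N, g.coeff j * (j : K) ^ i = 0 := by
  induction i with
  | zero =>
    intro m g hg hm hd
    have h1 : g.eval 1 = 0 := by
      obtain ⟨q, rfl⟩ := hd
      simp [show m ≠ 0 by omega]
    rw [Polynomial.eval_eq_sum_range' hg] at h1
    simpa using h1
  | succ i ih =>
    intro m g hg hm hd
    obtain ⟨m, rfl⟩ : ∃ k, m = k + 1 := ⟨m - 1, by omega⟩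
    have hdeg : (X * derivative g).natDegree < N := by
      by_cases h0 : derivative g = 0
      · rw [h0]; simp; omega
      · have h2 : g.natDegree ≠ 0 := by
          intro h
          exact h0 (derivative_of_natDegree_zero h)
        have h1 := natDegree_derivative_lt h2
        have h3 := natDegree_mul_le (p := (X : K[X])) (q := derivative g)
        have h4 := natDegree_X_le (R := K)
        omega
    have hd' : (X - C 1) ^ m ∣ X * derivative g := by
      obtain ⟨q, rfl⟩ := hd
      refine Dvd.dvd.mul_left ?_ _
      rw [derivative_mul, derivative_X_sub_C_pow]
      refine dvd_add (Dvd.dvd.mul_right ?_ _) (Dvd.dvd.mul_right (pow_dvd_pow _ (by omega)) _)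
      simp
    have := ih m _ hdeg (by omega) hd'
    rw [← this]
    refine Finset.sum_congr rfl fun j _ => ?_
    rcases j with _ | j
    · simp
    · rw [coeff_X_mul, coeff_derivative]
      push_cast
      ring

open Polynomial in
theorem aux_cheb1 {K : Type*} [CommRing K] [IsDomain K] (p : ℕ) [Fact p.Prime] [CharP K p]
    (A : Finset (ZMod p)) (v : ZMod p → K)
    (hd : (X - C 1) ^ A.card ∣ ∑ a ∈ A, C (v a) * X ^ a.val) : ∀ a ∈ A, v a = 0 := by
  classical
  set g : K[X] := ∑ a ∈ A, C (v a) * X ^ a.val with hg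
  have hdeg : g.natDegree < p := by
    have : g.natDegree ≤ p - 1 := by
      refine natDegree_sum_le_of_forall_le _ _ fun a _ => ?_
      refine (natDegree_C_mul_X_pow_le _ _).trans ?_
      have := ZMod.val_lt a
      omega
    have := (Fact.out : p.Prime).pos
    omega
  have hmom : ∀ i < A.card, ∑ a ∈ A, v a * (a.val : K) ^ i = 0 := by
    intro i hi
    have h := aux_moment p i A.card g hdeg hi hd
    rw [← h, hg]
    simp_rw [finsetSum_coeff, coeff_C_mul, coeff_X_pow, Finset.sum_mul]
    rw [Finset.sum_comm]
    refine Finset.sum_congr rfl fun a _ => ?_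
    rw [Finset.sum_eq_single a.val]
    · simp
    · intro b _ hb; simp [hb]
    · intro h; exact absurd (Finset.mem_range.2 (ZMod.val_lt a)) h
  let e := A.equivFin
  have hz : (fun i => v (e.symm i)) = 0 := by
    apply Matrix.eq_zero_of_forall_pow_sum_mul_pow_eq_zero
      (f := fun i => (((e.symm i : ZMod p).val : ℕ) : K))
    · intro i j hij
      simp only at hij
      rw [CharP.natCast_eq_natCast K p, ← ZMod.natCast_eq_natCast_iff] at hij
      simp only [ZMod.natCast_zmod_val] at hij
      exact e.symm.injective (Subtype.ext hij)
    · intro i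
      have := hmom i i.2
      rw [← Finset.sum_coe_sort] at this
      rw [← this]
      exact Equiv.sum_comp e.symm (fun a : A => v a * ((a : ZMod p).val : K) ^ (i : ℕ))
  intro a ha
  have := congrFun hz (e ⟨a, ha⟩)
  simpa using this

open Polynomial in
theorem aux_cheb2 {R : Type*} [CommRing R] [IsDomain R] [WfDvdMonoid R] (p : ℕ) [Fact p.Prime]
    (w : R) (hw : IsPrimitiveRoot w p) (hpr : Prime (w - 1))
    (A B : Finset (ZMod p)) (hAB : A.card = B.card) (v : ZMod p → R)
    (h0 : ∀ b ∈ B, ∑ a ∈ A, v a * w ^ (b.val * a.val) = 0) : ∀ a ∈ A, v a = 0 := by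
  classical
  have key : ∀ v : ZMod p → R, (∀ b ∈ B, ∑ a ∈ A, v a * w ^ (b.val * a.val) = 0) →
      ∀ a ∈ A, (w - 1) ∣ v a := by
    intro v h0
    let I := Ideal.span {w - 1}
    have hI : I.IsPrime := (Ideal.span_singleton_prime hpr.ne_zero).2 hpr
    have hp0 : (p : R ⧸ I) = 0 := by
      have h1 : (w - 1) ∣ (cyclotomic p R).eval w - (cyclotomic p R).eval 1 :=
        sub_dvd_eval_sub w 1 _
      have h2 : (cyclotomic p R).eval w = 0 := hw.isRoot_cyclotomic (Fact.out : p.Prime).pos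
      rw [h2, eval_one_cyclotomic_prime, zero_sub, dvd_neg] at h1
      have : (Ideal.Quotient.mk I) (p : R) = 0 :=
        Ideal.Quotient.eq_zero_iff_mem.2 (Ideal.mem_span_singleton.2 h1)
      simpa using this
    have : CharP (R ⧸ I) p := by
      rcases CharP.exists (R ⧸ I) with ⟨q, hq⟩
      have hd : q ∣ p := (CharP.cast_eq_zero_iff (R ⧸ I) q p).1 hp0
      rcases (Nat.dvd_prime (Fact.out : p.Prime)).1 hd with h | h
      · subst h
        exact absurd rfl (CharP.char_ne_one (R ⧸ I) 1)
      · exact h ▸ hq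
    set g : R[X] := ∑ a ∈ A, C (v a) * X ^ a.val with hg
    have hdvd : ∏ b ∈ B, (X - C (w ^ b.val)) ∣ g := by
      by_cases hg0 : g = 0
      · rw [hg0]; exact dvd_zero _
      have := (Multiset.prod_X_sub_C_dvd_iff_le_roots hg0 (B.image fun b => w ^ b.val).val).2
      have hinj : Set.InjOn (fun b : ZMod p => w ^ b.val) B := by
        intro x _ y _ hxy
        exact ZMod.val_injective p (hw.pow_inj (ZMod.val_lt x) (ZMod.val_lt y) hxy)
      have h3 : (Multiset.map (fun a => X - C a) (B.image fun b => w ^ b.val).val).prod =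
          ∏ b ∈ B, (X - C (w ^ b.val)) := by
        change ∏ a ∈ B.image _, (X - C a) = _
        rw [Finset.prod_image hinj]
      rw [h3] at this
      apply this
      rw [Multiset.le_iff_subset (Finset.nodup _)]
      intro x hx
      simp only [Finset.mem_val, Finset.mem_image] at hx
      obtain ⟨b, hb, rfl⟩ := hx
      rw [mem_roots hg0, IsRoot, hg, eval_finsetSum, ← h0 b hb]
      refine Finset.sum_congr rfl fun a _ => ?_
      simp [pow_mul]
    have hmap := Polynomial.map_dvd (Ideal.Quotient.mk I) hdvd
    have hw1 : Ideal.Quotient.mk I w = 1 := by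
      rw [← sub_eq_zero, ← map_one (Ideal.Quotient.mk I), ← map_sub]
      exact Ideal.Quotient.eq_zero_iff_mem.2 (Ideal.mem_span_singleton_self _)
    rw [Polynomial.map_prod, hg, Polynomial.map_sum] at hmap
    simp only [Polynomial.map_sub, Polynomial.map_mul, Polynomial.map_pow, map_X, map_C, map_pow,
      hw1, map_one, one_pow, Finset.prod_const] at hmap
    rw [← hAB] at hmap
    have := aux_cheb1 p A (fun a => Ideal.Quotient.mk I (v a))
      (by simpa using hmap)
    intro a ha
    exact Ideal.mem_span_singleton.1 (Ideal.Quotient.eq_zero_iff_mem.1 (this a ha))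
  have key2 : ∀ n : ℕ, ∀ v : ZMod p → R, (∀ b ∈ B, ∑ a ∈ A, v a * w ^ (b.val * a.val) = 0) →
      ∀ a ∈ A, (w - 1) ^ n ∣ v a := by
    intro n
    induction n with
    | zero => intro v _ a _; simp
    | succ n ih =>
      intro v hv
      have h1 := key v hv
      choose! u hu using h1
      have h2 := ih u (by
        intro b hb
        have := hv b hb
        rw [Finset.sum_congr rfl (fun a ha => by rw [hu a ha, mul_assoc]),
          ← Finset.mul_sum] at this
        exact (mul_eq_zero.1 this).resolve_left hpr.ne_zero)
      intro a ha
      rw [hu a ha, pow_succ']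
      exact mul_dvd_mul_left _ (h2 a ha)
  intro a ha
  by_contra hne
  obtain ⟨n, hn⟩ := FiniteMultiplicity.of_prime_left hpr hne
  exact hn (key2 (n + 1) v h0 a ha)

theorem aux_cheb3 (p : ℕ) [Fact p.Prime] (w : ℂ) (hw : IsPrimitiveRoot w p)
    (A B : Finset (ZMod p)) (hAB : A.card = B.card) (v : ZMod p → ℂ)
    (h0 : ∀ b ∈ B, ∑ a ∈ A, v a * w ^ (b.val * a.val) = 0) : ∀ a ∈ A, v a = 0 := by
  classical
  have : NeZero p := ⟨(Fact.out : p.Prime).ne_zero⟩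
  let K := CyclotomicField p ℚ
  have hK : IsCyclotomicExtension {p} ℚ K := CyclotomicField.isCyclotomicExtension p ℚ
  have hirr := Polynomial.cyclotomic.irreducible_rat (Fact.out : p.Prime).pos
  have hz := IsCyclotomicExtension.zeta_spec p ℚ K
  obtain ⟨φ, hφ⟩ := (hz.embeddingsEquivPrimitiveRoots ℂ hirr).surjective
    ⟨w, (mem_primitiveRoots (Fact.out : p.Prime).pos).2 hw⟩
  have hφ' : φ (IsCyclotomicExtension.zeta p ℚ K) = w := by
    rw [← hz.embeddingsEquivPrimitiveRoots_apply_coe ℂ hirr, hφ]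
  let ψ : NumberField.RingOfIntegers K →+* ℂ :=
    φ.toRingHom.comp (algebraMap (NumberField.RingOfIntegers K) K)
  have hψ : Function.Injective ψ := φ.toRingHom.injective.comp
    (NumberField.RingOfIntegers.coe_injective)
  have hψw : ψ hz.toInteger = w := hφ'
  have hpr := hz.zeta_sub_one_prime'
  let e : A ≃ B := Finset.equivOfCardEq hAB
  let M : Matrix A A (NumberField.RingOfIntegers K) :=
    fun i j => hz.toInteger ^ ((e i : ZMod p).val * (j : ZMod p).val)
  have hdet : M.det ≠ 0 := by
    intro hd
    obtain ⟨u, hu, hMu⟩ := Matrix.exists_mulVec_eq_zero_iff.2 hd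
    apply hu
    let u' : ZMod p → NumberField.RingOfIntegers K := fun a => if h : a ∈ A then u ⟨a, h⟩ else 0
    have := aux_cheb2 p hz.toInteger hz.toInteger_isPrimitiveRoot hpr A B hAB u' (by
      intro b hb
      have h1 := congrFun hMu (e.symm ⟨b, hb⟩)
      rw [← Finset.sum_coe_sort]
      simp only [Matrix.mulVec, dotProduct, M, Equiv.apply_symm_apply, Pi.zero_apply] at h1
      rw [← h1]
      refine Finset.sum_congr rfl fun a _ => ?_
      simp [u', mul_comm])
    funext a
    have h2 := this a a.2
    simpa [u'] using h2
  have hdet' : (M.map ψ).det ≠ 0 := by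
    rw [← RingHom.mapMatrix_apply, ← RingHom.map_det]
    exact (map_ne_zero_iff ψ hψ).2 hdet
  have hv : (fun a : A => v a) = 0 := by
    apply Matrix.eq_zero_of_mulVec_eq_zero hdet'
    funext i
    have h1 := h0 (e i) (e i).2
    rw [← Finset.sum_coe_sort] at h1
    simp only [Matrix.mulVec, dotProduct, Pi.zero_apply]
    rw [← h1]
    refine Finset.sum_congr rfl fun a _ => ?_
    have hM : M.map ψ i a = w ^ ((e i : ZMod p).val * (a : ZMod p).val) := by
      rw [Matrix.map_apply]
      change ψ (hz.toInteger ^ _) = _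
      rw [map_pow, hψw]
    rw [hM, mul_comm]
  intro a ha
  exact congrFun hv ⟨a, ha⟩

/-- unnormalised transform -/
noncomputable def auxT {p : ℕ} [NeZero p] (ψ : AddChar (ZMod p) ℂ) (f : ZMod p → ℂ)
    (k : ZMod p) : ℂ := ∑ l, ψ (k * l) * f l

theorem aux_uncert (p : ℕ) [Fact p.Prime] [NeZero p] (ψ : AddChar (ZMod p) ℂ) (hψ : ψ ≠ 1)
    (f : ZMod p → ℂ) (hf : f ≠ 0) :
    p + 1 ≤ (Finset.univ.filter fun x => f x ≠ 0).card +
      (Finset.univ.filter fun x => auxT ψ f x ≠ 0).card := by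
  classical
  have hval : ∀ x : ZMod p, ψ x = ψ 1 ^ x.val := by
    intro x
    rw [← AddChar.map_nsmul_eq_pow]; simp
  have hw : IsPrimitiveRoot (ψ 1) p := by
    have h1 : ψ 1 ^ p = 1 := by
      rw [← AddChar.map_nsmul_eq_pow]; simp
    have h2 : ψ 1 ≠ 1 := by
      intro h
      apply hψ
      ext x
      rw [hval x, h]; simp
    have := orderOf_eq_prime h1 h2
    exact IsPrimitiveRoot.iff_orderOf.2 this
  set A := Finset.univ.filter fun x => f x ≠ 0 with hA
  have hcard := Finset.card_filter_add_card_filter_not (s := (Finset.univ : Finset (ZMod p)))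
    (fun x => auxT ψ f x ≠ 0)
  rw [Finset.card_univ, ZMod.card] at hcard
  by_contra hlt
  push Not at hlt
  obtain ⟨B, hB, hBc⟩ := Finset.exists_subset_card_eq
    (s := Finset.univ.filter fun x => ¬ auxT ψ f x ≠ 0) (n := A.card) (by omega)
  have := aux_cheb3 p (ψ 1) hw A B hBc.symm f (by
    intro b hb
    have h1 := (Finset.mem_filter.1 (hB hb)).2
    push Not at h1
    rw [← h1, auxT, hA, Finset.sum_filter]
    refine Finset.sum_congr rfl fun a _ => ?_
    split_ifs with h
    · rw [hval (b * a), mul_comm, ZMod.val_mul]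
      congr 1
      conv_lhs => rw [← Nat.mod_add_div (b.val * a.val) p, pow_add, pow_mul, hw.pow_eq_one]
      simp
    · push Not at h; simp [h])
  apply hf
  funext x
  by_contra hx
  exact hx (this x (by simp [hA]; exact hx))

theorem aux_inv_ne_one {G : Type*} [Group G] {c : G →* ℂˣ} (hc : c ≠ 1) : c⁻¹ ≠ 1 := by
  intro h
  apply hc
  ext x
  have := DFunLike.congr_fun h x
  rw [MonoidHom.inv_apply, MonoidHom.one_apply, inv_eq_one] at this
  rw [this]; rfl

def AuxEq {p : ℕ} {H : Subgroup (ZMod p)ˣ} (c : H →* ℂˣ) (f : ZMod p → ℂ) : Prop :=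
  ∀ (h : H) (x : ZMod p), f (((h : (ZMod p)ˣ) : ZMod p) * x) = (c h : ℂ) * f x

open Classical in
noncomputable def auxS {p : ℕ} [NeZero p] (H : Subgroup (ZMod p)ˣ) (f : ZMod p → ℂ) :
    Finset ((ZMod p)ˣ ⧸ H) :=
  Finset.univ.filter fun q => f ((Quotient.out q : (ZMod p)ˣ) : ZMod p) ≠ 0

theorem auxEq_coset {p : ℕ} {H : Subgroup (ZMod p)ˣ} {c : H →* ℂˣ} {f : ZMod p → ℂ}
    (hf : AuxEq c f) {u v : (ZMod p)ˣ} (huv : (u : (ZMod p)ˣ ⧸ H) = v) :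
    f u = 0 ↔ f v = 0 := by
  have h := QuotientGroup.eq.1 huv
  have := hf ⟨_, h⟩ u
  simp only at this
  have h2 : ((u⁻¹ * v : (ZMod p)ˣ) : ZMod p) * u = v := by
    rw [← Units.val_mul]; congr 1; rw [mul_comm, mul_inv_cancel_left]
  rw [h2] at this
  rw [this]
  simp

theorem mem_auxS {p : ℕ} [NeZero p] {H : Subgroup (ZMod p)ˣ} {c : H →* ℂˣ} {f : ZMod p → ℂ}
    (hf : AuxEq c f) (u : (ZMod p)ˣ) : (u : (ZMod p)ˣ ⧸ H) ∈ auxS H f ↔ f u ≠ 0 := by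
  classical
  rw [auxS, Finset.mem_filter]
  simp only [Finset.mem_univ, true_and]
  exact (auxEq_coset hf (QuotientGroup.out_eq' _)).not

theorem auxEq_zero {p : ℕ} {H : Subgroup (ZMod p)ˣ} {c : H →* ℂˣ} {f : ZMod p → ℂ}
    (hf : AuxEq c f) (hc : c ≠ 1) : f 0 = 0 := by
  by_contra h0
  apply hc
  ext h
  have := hf h 0
  rw [mul_zero] at this
  simpa using (mul_eq_right₀ h0).1 this.symm

theorem aux_card {p : ℕ} [Fact p.Prime] [NeZero p] {H : Subgroup (ZMod p)ˣ} {c : H →* ℂˣ}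
    {f : ZMod p → ℂ} (hf : AuxEq c f) (hc : c ≠ 1) :
    (Finset.univ.filter fun x => f x ≠ 0).card = Nat.card H * (auxS H f).card := by
  classical
  have h1 := QuotientGroup.card_preimage_mk H (auxS H f : Set ((ZMod p)ˣ ⧸ H))
  have h2 : Nat.card (auxS H f : Set ((ZMod p)ˣ ⧸ H)) = (auxS H f).card := by simp
  have h3 : (Finset.univ.filter fun x => f x ≠ 0) =
      (Finset.univ.filter fun u : (ZMod p)ˣ => f u ≠ 0).map ⟨Units.val, Units.val_injective⟩ := by
    ext x
    simp only [Finset.mem_filter, Finset.mem_univ, true_and, Finset.mem_map,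
      Function.Embedding.coeFn_mk]
    constructor
    · intro hx
      have hx0 : x ≠ 0 := by
        rintro rfl
        exact hx (auxEq_zero hf hc)
      exact ⟨Units.mk0 x hx0, by simpa using hx, rfl⟩
    · rintro ⟨u, hu, rfl⟩
      exact hu
  have h4 : (QuotientGroup.mk ⁻¹' (auxS H f : Set ((ZMod p)ˣ ⧸ H)) : Set (ZMod p)ˣ) =
      ((Finset.univ.filter fun u : (ZMod p)ˣ => f u ≠ 0 : Finset (ZMod p)ˣ) : Set (ZMod p)ˣ) := by
    ext u
    simpa using mem_auxS hf u
  rw [← h2, ← h1, h3, Finset.card_map, h4]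
  simp

theorem aux_uncert' {p : ℕ} [Fact p.Prime] [NeZero p] {H : Subgroup (ZMod p)ˣ} {c : H →* ℂˣ}
    {f : ZMod p → ℂ} (hf : AuxEq c f) (hc : c ≠ 1) {ψ : AddChar (ZMod p) ℂ} (hψ : ψ ≠ 1)
    (hT : AuxEq c⁻¹ (auxT ψ f)) (hf0 : f ≠ 0) :
    H.index + 1 ≤ (auxS H f).card + (auxS H (auxT ψ f)).card := by
  have h1 := aux_uncert p ψ hψ f hf0
  rw [aux_card hf hc, aux_card hT (aux_inv_ne_one hc), ← mul_add] at h1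
  have h2 := H.index_mul_card
  rw [Nat.card_eq_fintype_card (α := (ZMod p)ˣ), ZMod.card_units] at h2
  by_contra hlt
  push Not at hlt
  have h3 : (auxS H f).card + (auxS H (auxT ψ f)).card ≤ H.index := by omega
  have h4 := Nat.mul_le_mul_left (Nat.card H) h3
  rw [mul_comm _ H.index] at h4
  have := Nat.card_pos (α := H)
  omega

theorem auxEq_T {p : ℕ} [NeZero p] {H : Subgroup (ZMod p)ˣ} {c : H →* ℂˣ}
    {f : ZMod p → ℂ} (hf : AuxEq c f) (ψ : AddChar (ZMod p) ℂ) : AuxEq c⁻¹ (auxT ψ f) := by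
  intro h x
  rw [auxT, auxT, Finset.mul_sum]
  rw [← Equiv.sum_comp (Units.mulLeft (h : (ZMod p)ˣ)) (fun l => ((c⁻¹ h : ℂˣ) : ℂ) * (ψ (x * l) * f l))]
  refine Finset.sum_congr rfl fun l _ => ?_
  rw [Units.mulLeft_apply, hf h l]
  have : ((c⁻¹ h : ℂˣ) : ℂ) * (c h : ℂ) = 1 := by
    rw [MonoidHom.inv_apply, Units.inv_mul]
  rw [show x * (((h : (ZMod p)ˣ) : ZMod p) * l) = ((h : (ZMod p)ˣ) : ZMod p) * x * l by ring]
  linear_combination (-ψ (((h : (ZMod p)ˣ) : ZMod p) * x * l) * f l) * this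

theorem auxEq_sub {p : ℕ} {H : Subgroup (ZMod p)ˣ} {c : H →* ℂˣ} {f g : ZMod p → ℂ}
    (hf : AuxEq c f) (hg : AuxEq c g) : AuxEq c (f - g) := by
  intro h x
  simp only [Pi.sub_apply, hf h x, hg h x]; ring

theorem auxEq_smul {p : ℕ} {H : Subgroup (ZMod p)ˣ} {c : H →* ℂˣ} {f : ZMod p → ℂ}
    (hf : AuxEq c f) (t : ℂ) : AuxEq c (t • f) := by
  intro h x
  simp only [Pi.smul_apply, hf h x, smul_eq_mul]; ring

theorem auxT_sub {p : ℕ} [NeZero p] (ψ : AddChar (ZMod p) ℂ) (f g : ZMod p → ℂ) :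
    auxT ψ (f - g) = auxT ψ f - auxT ψ g := by
  funext k; simp [auxT, mul_sub]

theorem auxT_smul {p : ℕ} [NeZero p] (ψ : AddChar (ZMod p) ℂ) (f : ZMod p → ℂ) (t : ℂ) :
    auxT ψ (t • f) = t • auxT ψ f := by
  funext k; simp [auxT, Finset.mul_sum]; exact Finset.sum_congr rfl fun _ _ => by ring

theorem auxS_sub {p : ℕ} [NeZero p] {H : Subgroup (ZMod p)ˣ} {f g : ZMod p → ℂ}
    {A : Finset ((ZMod p)ˣ ⧸ H)} (hf : auxS H f ⊆ A) (hg : auxS H g ⊆ A) :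
    auxS H (f - g) ⊆ A := by
  intro q hq
  by_contra hA
  have h1 := mt (@hf q) hA
  have h2 := mt (@hg q) hA
  simp [auxS] at hq h1 h2
  simp [h1, h2] at hq

theorem aux_unique {p : ℕ} [Fact p.Prime] [NeZero p] {H : Subgroup (ZMod p)ˣ} {c : H →* ℂˣ}
    (hc : c ≠ 1) {ψ : AddChar (ZMod p) ℂ} (hψ : ψ ≠ 1)
    {f g : ZMod p → ℂ} (hf : AuxEq c f) (hg : AuxEq c g) (h1 : f 1 = g 1)
    (A A' : Finset ((ZMod p)ˣ ⧸ H)) (h1A : ((1 : (ZMod p)ˣ) : (ZMod p)ˣ ⧸ H) ∈ A)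
    (hAA : A.card + A'.card = H.index + 1)
    (hfA : auxS H f ⊆ A) (hgA : auxS H g ⊆ A)
    (hfA' : auxS H (auxT ψ f) ⊆ A') (hgA' : auxS H (auxT ψ g) ⊆ A') : f = g := by
  classical
  by_contra hne
  have hd := auxEq_sub hf hg
  have hu := aux_uncert' hd hc hψ (auxEq_T hd ψ) (sub_ne_zero.2 hne)
  have h2 : auxS H (f - g) ⊆ A.erase ((1 : (ZMod p)ˣ) : (ZMod p)ˣ ⧸ H) := by
    rw [Finset.subset_erase]
    refine ⟨auxS_sub hfA hgA, ?_⟩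
    rw [mem_auxS hd]
    simp [h1]
  have h3 : auxS H (auxT ψ (f - g)) ⊆ A' := by
    rw [auxT_sub]; exact auxS_sub hfA' hgA'
  have h4 := Finset.card_le_card h2
  have h5 := Finset.card_le_card h3
  rw [Finset.card_erase_of_mem h1A] at h4
  have h6 := Finset.card_pos.2 ⟨_, h1A⟩
  omega

open Classical in
noncomputable def auxExt {p : ℕ} [NeZero p] {H : Subgroup (ZMod p)ˣ} (c : H →* ℂˣ)
    (v : ((ZMod p)ˣ ⧸ H) → ℂ) (x : ZMod p) : ℂ :=
  ∑ q, ∑ h : H, v q * (c h : ℂ) *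
    if ((h : (ZMod p)ˣ) : ZMod p) * ((Quotient.out q : (ZMod p)ˣ) : ZMod p) = x then 1 else 0

theorem auxExt_eq {p : ℕ} [NeZero p] {H : Subgroup (ZMod p)ˣ} (c : H →* ℂˣ)
    (v : ((ZMod p)ˣ ⧸ H) → ℂ) : AuxEq c (auxExt c v) := by
  classical
  intro k x
  simp only [auxExt, Finset.mul_sum]
  refine Finset.sum_congr rfl fun q _ => ?_
  rw [← Equiv.sum_comp (Equiv.mulLeft k)]
  refine Finset.sum_congr rfl fun h _ => ?_
  simp only [Equiv.coe_mulLeft, Subgroup.coe_mul, Units.val_mul, mul_assoc, map_mul]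
  simp only [Units.mul_right_inj]
  ring

theorem auxExt_out {p : ℕ} [NeZero p] {H : Subgroup (ZMod p)ˣ} (c : H →* ℂˣ)
    (v : ((ZMod p)ˣ ⧸ H) → ℂ) (q : (ZMod p)ˣ ⧸ H) :
    auxExt c v ((Quotient.out q : (ZMod p)ˣ) : ZMod p) = v q := by
  classical
  rw [auxExt, Finset.sum_eq_single q, Finset.sum_eq_single 1]
  · simp
  · intro h _ hh
    rw [if_neg, mul_zero]
    intro he
    rw [← Units.val_mul, Units.val_inj, mul_eq_right] at he
    exact hh (Subtype.ext he)
  · simp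
  · intro r _ hr
    refine Finset.sum_eq_zero fun h _ => ?_
    rw [if_neg, mul_zero]
    intro he
    rw [← Units.val_mul, Units.val_inj] at he
    apply hr
    rw [← QuotientGroup.out_eq' r, ← QuotientGroup.out_eq' q, QuotientGroup.eq]
    simp only [← he]
    rw [mul_comm (h : (ZMod p)ˣ), inv_mul_cancel_left]
    exact h.2
  · simp

theorem aux_exists {p : ℕ} [Fact p.Prime] [NeZero p] {H : Subgroup (ZMod p)ˣ} {c : H →* ℂˣ}
    (hc : c ≠ 1) {ψ : AddChar (ZMod p) ℂ} (hψ : ψ ≠ 1)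
    (A A' : Finset ((ZMod p)ˣ ⧸ H)) (h1A : ((1 : (ZMod p)ˣ) : (ZMod p)ˣ ⧸ H) ∈ A)
    (hAA : A.card + A'.card = H.index + 1) :
    ∃ f : ZMod p → ℂ, AuxEq c f ∧ f 1 = 1 ∧ auxS H f = A ∧ auxS H (auxT ψ f) = A' := by
  classical
  let E : (A → ℂ) → ((ZMod p)ˣ ⧸ H) → ℂ := fun v q => if h : q ∈ A then v ⟨q, h⟩ else 0
  let L : (A → ℂ) →ₗ[ℂ] ((A'ᶜ : Finset _) → ℂ) :=
    { toFun := fun v q => auxT ψ (auxExt c (E v)) ((Quotient.out q.1 : (ZMod p)ˣ) : ZMod p)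
      map_add' := by
        intro v w
        funext q
        simp only [Pi.add_apply, auxT, auxExt, ← Finset.sum_add_distrib, ← mul_add, ← add_mul]
        have : ∀ q, E (v + w) q = E v q + E w q := by
          intro q; simp only [E]; split_ifs <;> simp
        simp only [this]
      map_smul' := by
        intro t v
        funext q
        have : ∀ q, E (t • v) q = t * E v q := by
          intro q; simp only [E]; split_ifs <;> simp
        simp only [auxT, auxExt, this, Pi.smul_apply, smul_eq_mul, RingHom.id_apply,
          Finset.mul_sum]
        refine Finset.sum_congr rfl fun _ _ => Finset.sum_congr rfl fun _ _ =>
          Finset.sum_congr rfl fun _ _ => by ring }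
  have hidx : H.index = Fintype.card ((ZMod p)ˣ ⧸ H) := by
    rw [Subgroup.index, Nat.card_eq_fintype_card]
  have hA'le : A'.card ≤ Fintype.card ((ZMod p)ˣ ⧸ H) := Finset.card_le_univ _
  have hker : L.ker ≠ ⊥ := by
    apply LinearMap.ker_ne_bot_of_finrank_lt
    simp only [Module.finrank_fintype_fun_eq_card, Fintype.card_coe, Finset.card_compl]
    omega
  obtain ⟨v, hv, hv0⟩ := (Submodule.ne_bot_iff _).1 hker
  set f := auxExt c (E v) with hfdef
  have hf : AuxEq c f := auxExt_eq c _
  have hf0 : f ≠ 0 := by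
    intro h
    apply hv0
    funext q
    have := auxExt_out c (E v) q.1
    rw [← hfdef, h] at this
    simpa [E] using this.symm
  have hfA : auxS H f ⊆ A := by
    intro q hq
    by_contra hqA
    simp [auxS, hfdef, auxExt_out, E, hqA] at hq
  have hfA' : auxS H (auxT ψ f) ⊆ A' := by
    intro q hq
    by_contra hqA
    have := congrFun (LinearMap.mem_ker.1 hv) ⟨q, Finset.mem_compl.2 hqA⟩
    simp only [auxS, Finset.mem_filter] at hq
    exact hq.2 this
  have hu := aux_uncert' hf hc hψ (auxEq_T hf ψ) hf0
  have h4 := Finset.card_le_card hfA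
  have h5 := Finset.card_le_card hfA'
  have e1 : auxS H f = A := Finset.eq_of_subset_of_card_le hfA (by omega)
  have e2 : auxS H (auxT ψ f) = A' := Finset.eq_of_subset_of_card_le hfA' (by omega)
  have hf1 : f 1 ≠ 0 := by
    rw [← e1, mem_auxS hf] at h1A
    simpa using h1A
  refine ⟨(f 1)⁻¹ • f, auxEq_smul hf _, by simp [hf1], ?_, ?_⟩
  · rw [← e1]; ext q; simp [auxS, hf1]
  · rw [← e2, auxT_smul]; ext q; simp [auxS, hf1]

theorem aux_parseval {p : ℕ} [Fact p.Prime] [NeZero p] {ψ : AddChar (ZMod p) ℂ} (hψ : ψ ≠ 1)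
    (f g : ZMod p → ℂ) :
    ∑ k, auxT ψ f k * auxT ψ⁻¹ g k = p * ∑ x, f x * g x := by
  classical
  have hprim : ψ.IsPrimitive := AddChar.IsPrimitive.of_ne_one hψ
  have : ∀ k, auxT ψ f k * auxT ψ⁻¹ g k = ∑ l, ∑ m, f l * g m * ψ (k * (l - m)) := by
    intro k
    rw [auxT, auxT, Finset.sum_mul_sum]
    refine Finset.sum_congr rfl fun l _ => Finset.sum_congr rfl fun m _ => ?_
    rw [AddChar.inv_apply, mul_sub, sub_eq_add_neg, AddChar.map_add_eq_mul]
    ring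
  simp only [this]
  rw [Finset.sum_comm, Finset.mul_sum]
  refine Finset.sum_congr rfl fun l _ => ?_
  rw [Finset.sum_comm]
  simp only [← Finset.mul_sum, AddChar.sum_mulShift _ hprim]
  rw [Finset.sum_eq_single l]
  · simp [ZMod.card]; ring
  · intro m _ hm
    rw [if_neg (sub_ne_zero.2 hm.symm)]; simp
  · simp

theorem aux_count {Q : Type*} [Fintype Q] [DecidableEq Q] (o : Q) :
    ((Finset.univ : Finset (Finset Q × Finset Q)).filter fun P =>
      o ∈ P.1 ∧ o ∈ P.2 ∧ P.1.card + P.2.card = Fintype.card Q + 1).card =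
    Nat.choose (2 * Fintype.card Q - 2) (Fintype.card Q - 1) := by
  have hpos : 0 < Fintype.card Q := Fintype.card_pos_iff.2 ⟨o⟩
  have hc : (((Finset.univ : Finset Q).erase o).disjSum ((Finset.univ : Finset Q).erase o)).card =
      2 * Fintype.card Q - 2 := by
    rw [Finset.card_disjSum, Finset.card_erase_of_mem (Finset.mem_univ _), Finset.card_univ]
    omega
  rw [← hc, ← Finset.card_powersetCard]
  refine Finset.card_bij' (fun P _ => (P.1.erase o).disjSum (P.2.erase o))
    (fun T _ => (insert o T.toLeft, insert o T.toRight)) ?_ ?_ ?_ ?_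
  · rintro ⟨A, B⟩ h
    simp only [Finset.mem_filter, Finset.mem_univ, true_and] at h
    obtain ⟨h1, h2, h3⟩ := h
    rw [Finset.mem_powersetCard]
    refine ⟨Finset.disjSum_mono (Finset.erase_subset_erase _ (Finset.subset_univ _))
      (Finset.erase_subset_erase _ (Finset.subset_univ _)), ?_⟩
    rw [Finset.card_disjSum, Finset.card_erase_of_mem h1, Finset.card_erase_of_mem h2]
    have := Finset.card_pos.2 ⟨_, h1⟩
    have := Finset.card_pos.2 ⟨_, h2⟩
    omega
  · intro T hT
    rw [Finset.mem_powersetCard] at hT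
    have hl : o ∉ T.toLeft := by
      intro h
      have := hT.1 (Finset.mem_toLeft.1 h)
      simp at this
    have hr : o ∉ T.toRight := by
      intro h
      have := hT.1 (Finset.mem_toRight.1 h)
      simp at this
    simp only [Finset.mem_filter, Finset.mem_univ, true_and, Finset.mem_insert_self]
    rw [Finset.card_insert_of_notMem hl, Finset.card_insert_of_notMem hr]
    have := Finset.card_toLeft_add_card_toRight (u := T)
    omega
  · rintro ⟨A, B⟩ h
    simp only [Finset.mem_filter, Finset.mem_univ, true_and] at h
    simp [h.1, h.2.1]
  · intro T hT
    rw [Finset.mem_powersetCard] at hT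
    have hl : o ∉ T.toLeft := by
      intro h
      have := hT.1 (Finset.mem_toLeft.1 h)
      simp at this
    have hr : o ∉ T.toRight := by
      intro h
      have := hT.1 (Finset.mem_toRight.1 h)
      simp at this
    simp only [Finset.erase_insert hl, Finset.erase_insert hr]
    exact Finset.toLeft_disjSum_toRight

theorem aux_ind_unit {p : ℕ} (H : Subgroup (ZMod p)ˣ) (u : (ZMod p)ˣ) [Decidable (u ∈ H)] :
    indSubgroup H (u : ZMod p) = if u ∈ H then 1 else 0 := by
  rw [indSubgroup]
  have : (∃ v ∈ H, ((v : (ZMod p)ˣ) : ZMod p) = u) ↔ u ∈ H := by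
    constructor
    · rintro ⟨v, hv, h⟩
      rwa [← Units.val_injective h]
    · intro h; exact ⟨u, h, rfl⟩
  simp only [this]

theorem aux_inter {p : ℕ} [NeZero p] {H : Subgroup (ZMod p)ˣ} {c d : H →* ℂˣ}
    [DecidableEq ((ZMod p)ˣ ⧸ H)]
    {f g : ZMod p → ℂ} (hf : AuxEq c f) (hg : AuxEq d g) {K : ℂ} (hK : K ≠ 0)
    (h : ∀ x, f x * g x = K * indSubgroup H x) :
    auxS H f ∩ auxS H g = {((1 : (ZMod p)ˣ) : (ZMod p)ˣ ⧸ H)} := by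
  classical
  ext q
  obtain ⟨u, rfl⟩ := QuotientGroup.mk_surjective q
  rw [Finset.mem_inter, mem_auxS hf, mem_auxS hg, ← mul_ne_zero_iff, h, aux_ind_unit,
    Finset.mem_singleton]
  rw [QuotientGroup.mk_one, QuotientGroup.eq_one_iff]
  simp [hK]

theorem aux_comb {Q : Type*} [Fintype Q] [DecidableEq Q] {o : Q} {A B : Finset Q}
    (h : A ∩ B = {o}) : A.card + B.card ≤ Fintype.card Q + 1 ∧
      (A.card + B.card = Fintype.card Q + 1 → B = insert o Aᶜ) := by
  have h1 := Finset.card_union_add_card_inter A B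
  rw [h, Finset.card_singleton] at h1
  have h2 := Finset.card_le_univ (A ∪ B)
  refine ⟨by omega, fun h3 => ?_⟩
  have h4 : A ∪ B = Finset.univ := (Finset.card_eq_iff_eq_univ _).1 (by omega)
  ext q
  have h5 := Finset.ext_iff.1 h q
  have h6 := Finset.ext_iff.1 h4 q
  simp at h5 h6 ⊢
  tauto

/-- If the product of `f` and `g` is supported on `H`, it is a multiple of the indicator. -/
theorem aux_prod {p : ℕ} [Fact p.Prime] [NeZero p] {H : Subgroup (ZMod p)ˣ} {c : H →* ℂˣ}
    [DecidableEq ((ZMod p)ˣ ⧸ H)] (hc : c ≠ 1)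
    {f g : ZMod p → ℂ} (hf : AuxEq c f) (hg : AuxEq c⁻¹ g)
    (h : auxS H f ∩ auxS H g = {((1 : (ZMod p)ˣ) : (ZMod p)ˣ ⧸ H)}) (x : ZMod p) :
    f x * g x = f 1 * g 1 * indSubgroup H x := by
  classical
  by_cases hx : x = 0
  · subst hx
    rw [auxEq_zero hf hc, indSubgroup, if_neg]
    · simp
    · rintro ⟨u, _, hu⟩
      exact u.ne_zero hu
  obtain ⟨u, rfl⟩ : ∃ u : (ZMod p)ˣ, (u : ZMod p) = x := ⟨Units.mk0 x hx, rfl⟩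
  rw [aux_ind_unit]
  split_ifs with hu
  · have h1 := hf ⟨u, hu⟩ 1
    have h2 := hg ⟨u, hu⟩ 1
    simp only [mul_one] at h1 h2
    have : ((c⁻¹ ⟨u, hu⟩ : ℂˣ) : ℂ) * (c ⟨u, hu⟩ : ℂ) = 1 := by
      rw [MonoidHom.inv_apply, Units.inv_mul]
    rw [h1, h2]
    linear_combination (f 1 * g 1) * this
  · have h5 := Finset.ext_iff.1 h u
    rw [Finset.mem_inter, mem_auxS hf, mem_auxS hg, ← mul_ne_zero_iff,
      Finset.mem_singleton, QuotientGroup.mk_one, QuotientGroup.eq_one_iff] at h5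
    rw [mul_zero]
    by_contra hne
    exact hu (h5.1 hne)

theorem aux_sum_ind {p : ℕ} [NeZero p] (H : Subgroup (ZMod p)ˣ) :
    ∑ x, indSubgroup H x ≠ 0 := by
  classical
  have hs : ∑ x, indSubgroup H x =
      ((Finset.univ.filter fun x : ZMod p => ∃ u ∈ H, ((u : (ZMod p)ˣ) : ZMod p) = x).card : ℂ) := by
    rw [Finset.card_filter]
    push_cast
    refine Finset.sum_congr rfl fun x _ => ?_
    rw [indSubgroup]
    by_cases hx : ∃ u ∈ H, ((u : (ZMod p)ˣ) : ZMod p) = x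
    · rw [if_pos hx, if_pos hx]
    · rw [if_neg hx, if_neg hx]
  rw [hs, Nat.cast_ne_zero, ← Nat.pos_iff_ne_zero, Finset.card_pos]
  exact ⟨1, by simp only [Finset.mem_filter, Finset.mem_univ, true_and]; exact ⟨1, H.one_mem, rfl⟩⟩

def AuxSet {p : ℕ} [NeZero p] (H : Subgroup (ZMod p)ˣ) (c : H →* ℂˣ) (ψ : AddChar (ZMod p) ℂ) :
    Set ((ZMod p → ℂ) × (ZMod p → ℂ)) :=
  {fg | AuxEq c fg.1 ∧ AuxEq c⁻¹ fg.2 ∧ fg.1 1 = 1 ∧ fg.2 1 = 1 ∧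
    (∀ x, fg.1 x * fg.2 x = indSubgroup H x) ∧
    ∀ k, auxT ψ fg.1 k * auxT ψ⁻¹ fg.2 k = p * indSubgroup H k}

theorem aux_struct {p : ℕ} [Fact p.Prime] [NeZero p] {H : Subgroup (ZMod p)ˣ} {c : H →* ℂˣ}
    (hc : c ≠ 1) {ψ : AddChar (ZMod p) ℂ} (hψ : ψ ≠ 1) [DecidableEq ((ZMod p)ˣ ⧸ H)]
    [Fintype ((ZMod p)ˣ ⧸ H)]
    {fg : (ZMod p → ℂ) × (ZMod p → ℂ)} (h : fg ∈ AuxSet H c ψ) :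
    ((1 : (ZMod p)ˣ) : (ZMod p)ˣ ⧸ H) ∈ auxS H fg.1 ∧
    ((1 : (ZMod p)ˣ) : (ZMod p)ˣ ⧸ H) ∈ auxS H (auxT ψ fg.1) ∧
    (auxS H fg.1).card + (auxS H (auxT ψ fg.1)).card = H.index + 1 ∧
    (auxS H fg.2).card + (auxS H (auxT ψ⁻¹ fg.2)).card = H.index + 1 ∧
    auxS H fg.2 = insert ((1 : (ZMod p)ˣ) : (ZMod p)ˣ ⧸ H) (auxS H fg.1)ᶜ ∧
    auxS H (auxT ψ⁻¹ fg.2) =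
      insert ((1 : (ZMod p)ˣ) : (ZMod p)ˣ ⧸ H) (auxS H (auxT ψ fg.1))ᶜ := by
  obtain ⟨hf, hg, hf1, hg1, h1, h2⟩ := h
  have hidx : H.index = Fintype.card ((ZMod p)ˣ ⧸ H) := by
    rw [Subgroup.index, Nat.card_eq_fintype_card]
  have hp : (p : ℂ) ≠ 0 := NeZero.ne _
  have i1 := aux_inter hf hg one_ne_zero (by simpa using h1)
  have i2 := aux_inter (auxEq_T hf ψ) (auxEq_T hg ψ⁻¹) hp h2
  have hf0 : fg.1 ≠ 0 := by
    intro h; rw [h] at hf1; simp at hf1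
  have hg0 : fg.2 ≠ 0 := by
    intro h; rw [h] at hg1; simp at hg1
  have u1 := aux_uncert' hf hc hψ (auxEq_T hf ψ) hf0
  have u2 := aux_uncert' hg (aux_inv_ne_one hc) (inv_ne_one.2 hψ) (auxEq_T hg ψ⁻¹) hg0
  obtain ⟨a1, b1⟩ := aux_comb i1
  obtain ⟨a2, b2⟩ := aux_comb i2
  rw [← hidx] at a1 a2 b1 b2
  refine ⟨?_, ?_, by omega, by omega, b1 (by omega), b2 (by omega)⟩
  · exact (Finset.mem_inter.1 (i1 ▸ Finset.mem_singleton_self _)).1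
  · exact (Finset.mem_inter.1 (i2 ▸ Finset.mem_singleton_self _)).1

theorem aux_main {p : ℕ} [Fact p.Prime] [NeZero p] {H : Subgroup (ZMod p)ˣ} {c : H →* ℂˣ}
    (hc : c ≠ 1) {ψ : AddChar (ZMod p) ℂ} (hψ : ψ ≠ 1) :
    (AuxSet H c ψ).Finite ∧
      Nat.card (AuxSet H c ψ) = Nat.choose (2 * H.index - 2) (H.index - 1) := by
  classical
  have hidx : H.index = Fintype.card ((ZMod p)ˣ ⧸ H) := by
    rw [Subgroup.index, Nat.card_eq_fintype_card]
  let o : (ZMod p)ˣ ⧸ H := ((1 : (ZMod p)ˣ) : (ZMod p)ˣ ⧸ H)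
  let T := (Finset.univ : Finset (Finset ((ZMod p)ˣ ⧸ H) × Finset ((ZMod p)ˣ ⧸ H))).filter fun P =>
      o ∈ P.1 ∧ o ∈ P.2 ∧ P.1.card + P.2.card = Fintype.card ((ZMod p)ˣ ⧸ H) + 1
  let Φ : (ZMod p → ℂ) × (ZMod p → ℂ) → Finset ((ZMod p)ˣ ⧸ H) × Finset ((ZMod p)ˣ ⧸ H) :=
    fun fg => (auxS H fg.1, auxS H (auxT ψ fg.1))
  have hbij : Set.BijOn Φ (AuxSet H c ψ) (T : Set _) := by
    refine ⟨?_, ?_, ?_⟩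
    · intro fg h
      obtain ⟨s1, s2, s3, -⟩ := aux_struct hc hψ h
      simp only [T, Φ, Finset.coe_filter, Finset.mem_univ, true_and, Set.mem_ofPred_eq]
      exact ⟨s1, s2, by rw [s3, hidx]⟩
    · rintro ⟨f, g⟩ h ⟨f', g'⟩ h' he
      obtain ⟨s1, s2, s3, s4, s5, s6⟩ := aux_struct hc hψ h
      obtain ⟨t1, t2, t3, t4, t5, t6⟩ := aux_struct hc hψ h'
      obtain ⟨hf, hg, hf1, hg1, -⟩ := h
      obtain ⟨hf', hg', hf1', hg1', -⟩ := h'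
      simp only [Φ, Prod.mk.injEq] at *
      obtain ⟨e1, e2⟩ := he
      refine ⟨?_, ?_⟩
      · exact aux_unique hc hψ hf hf' (hf1.trans hf1'.symm) _ _ s1 s3 subset_rfl e1.symm.subset
          subset_rfl e2.symm.subset
      · refine aux_unique (aux_inv_ne_one hc) (inv_ne_one.2 hψ) hg hg' (hg1.trans hg1'.symm)
          _ _ ?_ s4 subset_rfl ?_ subset_rfl ?_
        · rw [s5]; exact Finset.mem_insert_self _ _
        · rw [s5, t5, e1]
        · rw [s6, t6, e2]
    · rintro ⟨A, A'⟩ hA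
      simp only [T, Finset.coe_filter, Finset.mem_univ, true_and, Set.mem_ofPred_eq] at hA
      obtain ⟨hA, hA', hAA⟩ := hA
      rw [← hidx] at hAA
      obtain ⟨f, hf, hf1, hfA, hfA'⟩ := aux_exists hc hψ A A' hA hAA
      have hoA : o ∉ Aᶜ := by simpa using hA
      have hoA' : o ∉ A'ᶜ := by simpa using hA'
      have l1 : A.card ≤ Fintype.card ((ZMod p)ˣ ⧸ H) := Finset.card_le_univ _
      have l2 : A'.card ≤ Fintype.card ((ZMod p)ˣ ⧸ H) := Finset.card_le_univ _
      obtain ⟨g, hg, hg1, hgA, hgA'⟩ := aux_exists (aux_inv_ne_one hc) (inv_ne_one.2 hψ)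
        (insert o Aᶜ) (insert o A'ᶜ) (Finset.mem_insert_self _ _) (by
          rw [Finset.card_insert_of_notMem hoA, Finset.card_insert_of_notMem hoA',
            Finset.card_compl, Finset.card_compl]
          omega)
      have hfg := aux_prod hc hf hg (by
        rw [hfA, hgA]
        ext q
        simp only [Finset.mem_inter, Finset.mem_insert, Finset.mem_compl, Finset.mem_singleton]
        constructor
        · tauto
        · intro h; subst h; exact ⟨hA, Or.inl rfl⟩)
      have hTfg := aux_prod (aux_inv_ne_one hc) (auxEq_T hf ψ) (auxEq_T hg ψ⁻¹) (by
        rw [hfA', hgA']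
        ext q
        simp only [Finset.mem_inter, Finset.mem_insert, Finset.mem_compl, Finset.mem_singleton]
        constructor
        · tauto
        · intro h; subst h; exact ⟨hA', Or.inl rfl⟩)
      simp only [hf1, hg1, one_mul] at hfg
      have hP := aux_parseval hψ f g
      rw [Finset.sum_congr rfl (fun x _ => hTfg x), Finset.sum_congr rfl (fun x _ => hfg x),
        ← Finset.mul_sum] at hP
      have hK := mul_right_cancel₀ (aux_sum_ind H) hP
      rw [hK] at hTfg
      exact ⟨(f, g), ⟨hf, hg, hf1, hg1, hfg, hTfg⟩, by simp only [Φ, hfA, hfA']⟩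
  have hcnt := aux_count o
  refine ⟨hbij.finite_iff_finite.2 (Finset.finite_toSet T), ?_⟩
  rw [Nat.card_congr hbij.equiv, hidx, ← hcnt]
  simp [T]

theorem aux_star {p : ℕ} [NeZero p] {H : Subgroup (ZMod p)ˣ} (c : H →* ℂˣ) (h : H) :
    (starRingEnd ℂ) (c h : ℂ) = ((c⁻¹ h : ℂˣ) : ℂ) := by
  have hfin : IsOfFinOrder h := isOfFinOrder_of_finite h
  have h1 : ‖(c h : ℂ)‖ = 1 := by
    obtain ⟨n, hn, hn1⟩ := isOfFinOrder_iff_pow_eq_one.1 hfin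
    apply Complex.norm_eq_one_of_pow_eq_one (n := n) _ hn.ne'
    rw [← Units.val_pow_eq_pow_val, ← map_pow, hn1]; simp
  rw [MonoidHom.inv_apply, Units.val_inv_eq_inv_val, ← Complex.inv_eq_conj h1]

theorem aux_fourier {p : ℕ} [NeZero p] (f : ZMod p → ℂ) (k : ZMod p) :
    fourierZMod f k = (1 / Real.sqrt p) * auxT ZMod.stdAddChar f k := by
  rw [fourierZMod, auxT]
  simp only [ZMod.stdAddChar_apply, ZMod.toCircle_apply]

theorem aux_fourier_neg {p : ℕ} [NeZero p] (f : ZMod p → ℂ) (k : ZMod p) :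
    fourierZMod (fun x => f (-x)) k =
      (1 / Real.sqrt p) * auxT (ZMod.stdAddChar (N := p))⁻¹ f k := by
  rw [aux_fourier, auxT, auxT, ← Equiv.sum_comp (Equiv.neg (ZMod p))]
  simp [AddChar.inv_apply]

/-- **Theorem 6.6 together with Lemma 6.8** (fiber over `(1_H, 1_H)`).
Let `p` be an odd prime, `H ⊊ 𝔽_p^*` a proper subgroup of index `n`, and
`c : H → ℂ*` a non-trivial character.  Then the set of pairs `(f, g)` with `f`
`(H,c)`-equivariant, `g` `(H,c̄)`-equivariant, `f 1 = g 1 = 1`, `f·g = 1_H` and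
`f̂·(ǧ)^ = 1_H` is finite with cardinality `binom (2n-2) (n-1)`. -/
theorem card_fiber_eq_centralBinom
    (p : ℕ) (hp : p.Prime) (hodd : p ≠ 2)
    (H : Subgroup (ZMod p)ˣ) (hH : H ≠ ⊤) (c : H →* ℂˣ) (hc : c ≠ 1) :
    haveI : NeZero p := ⟨hp.ne_zero⟩
    Set.Finite {fg : (ZMod p → ℂ) × (ZMod p → ℂ) |
      (∀ (h : H) (x : ZMod p),
        fg.1 (((h : (ZMod p)ˣ) : ZMod p) * x) = (c h : ℂ) * fg.1 x) ∧
      (∀ (h : H) (x : ZMod p),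
        fg.2 (((h : (ZMod p)ˣ) : ZMod p) * x) = (starRingEnd ℂ) (c h : ℂ) * fg.2 x) ∧
      fg.1 1 = 1 ∧ fg.2 1 = 1 ∧
      (∀ x : ZMod p, fg.1 x * fg.2 x = indSubgroup H x) ∧
      (∀ k : ZMod p, fourierZMod fg.1 k * fourierZMod (fun x => fg.2 (-x)) k =
        indSubgroup H k)} ∧
    Nat.card {fg : (ZMod p → ℂ) × (ZMod p → ℂ) |
      (∀ (h : H) (x : ZMod p),
        fg.1 (((h : (ZMod p)ˣ) : ZMod p) * x) = (c h : ℂ) * fg.1 x) ∧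
      (∀ (h : H) (x : ZMod p),
        fg.2 (((h : (ZMod p)ˣ) : ZMod p) * x) = (starRingEnd ℂ) (c h : ℂ) * fg.2 x) ∧
      fg.1 1 = 1 ∧ fg.2 1 = 1 ∧
      (∀ x : ZMod p, fg.1 x * fg.2 x = indSubgroup H x) ∧
      (∀ k : ZMod p, fourierZMod fg.1 k * fourierZMod (fun x => fg.2 (-x)) k =
        indSubgroup H k)} = Nat.choose (2 * H.index - 2) (H.index - 1) := by
  have : NeZero p := ⟨hp.ne_zero⟩
  have : Fact p.Prime := ⟨hp⟩
  have hψ : (ZMod.stdAddChar (N := p)) ≠ 1 := by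
    intro h
    have h1 := ZMod.isPrimitive_stdAddChar p (one_ne_zero)
    apply h1
    rw [h]
    ext x
    simp
  have hm := aux_main hc hψ
  have hs : AuxSet H c (ZMod.stdAddChar (N := p)) = {fg : (ZMod p → ℂ) × (ZMod p → ℂ) |
      (∀ (h : H) (x : ZMod p),
        fg.1 (((h : (ZMod p)ˣ) : ZMod p) * x) = (c h : ℂ) * fg.1 x) ∧
      (∀ (h : H) (x : ZMod p),
        fg.2 (((h : (ZMod p)ˣ) : ZMod p) * x) = (starRingEnd ℂ) (c h : ℂ) * fg.2 x) ∧
      fg.1 1 = 1 ∧ fg.2 1 = 1 ∧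
      (∀ x : ZMod p, fg.1 x * fg.2 x = indSubgroup H x) ∧
      (∀ k : ZMod p, fourierZMod fg.1 k * fourierZMod (fun x => fg.2 (-x)) k =
        indSubgroup H k)} := by
    ext fg
    simp only [AuxSet, AuxEq, Set.mem_ofPred_eq, aux_star, aux_fourier_neg]
    simp only [aux_fourier]
    have hpc : (p : ℂ) ≠ 0 := NeZero.ne _
    have hsq : ((Real.sqrt p : ℝ) : ℂ) * ((Real.sqrt p : ℝ) : ℂ) = p := by
      rw [← Complex.ofReal_mul, Real.mul_self_sqrt (Nat.cast_nonneg p)]; simp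
    have hk : ∀ a b t : ℂ, a * b = p * t ↔
        (1 / ((Real.sqrt p : ℝ) : ℂ) * a) * (1 / ((Real.sqrt p : ℝ) : ℂ) * b) = t := by
      intro a b t
      have : (1 / ((Real.sqrt p : ℝ) : ℂ) * a) * (1 / ((Real.sqrt p : ℝ) : ℂ) * b) =
          a * b / p := by
        rw [← hsq]; ring
      rw [this, div_eq_iff hpc, mul_comm t]
    simp only [hk]
  rw [hs] at hm
  exact hm
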